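/- Let N ≥ 1, max{-4, -N} < 2b < 0 and 1 < q < q^*, where q^* := 1 + (4+2b)/(N-4) if N ≥ 5 and q^* := ∞ if 1 ≤ N ≤ 4. Then there exists a constant C = C(N, q, b) > 0 such that for every Schwartz function v on ℝ^N, ∫_{ℝ^N} |x|^{2b} |v(x)|^{2q} dx ≤ C ‖v‖₂^{E} ‖Δv‖₂^{D}, where D := (Nq - N - 2b)/2 and E := 2q - D. -/

import Mathlib

open MeasureTheory Filter Complex SchwartzMap
open scoped FourierTransform ENNReal NNReal

noncomputable section

/-- `N`-dimensional Euclidean space. -/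
abbrev EV (N : ℕ) := EuclideanSpace ℝ (Fin N)

/-- Partial derivative in the `j`-th coordinate direction. -/
def pd {N : ℕ} {F : Type*} [NormedAddCommGroup F] [NormedSpace ℝ F]
    (j : Fin N) (f : EV N → F) : EV N → F :=
  fun x => fderiv ℝ f x (EuclideanSpace.single j 1)

/-- The Laplacian, as the sum of the second partial derivatives. -/
def lap {N : ℕ} {F : Type*} [NormedAddCommGroup F] [NormedSpace ℝ F]
    (f : EV N → F) : EV N → F :=
  fun x => ∑ j : Fin N, pd j (pd j f) x

/-- The mass `∫ |f|²`. -/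
def massI {N : ℕ} (f : EV N → ℂ) : ℝ := ∫ x : EV N, ‖f x‖ ^ 2

/-- The `L²` norm. -/
def L2 {N : ℕ} (f : EV N → ℂ) : ℝ := (massI f) ^ ((1 : ℝ)/2)

/-- The `H²` norm `(‖f‖₂² + ‖Δf‖₂²)^(1/2)`. -/
def H2n {N : ℕ} (f : EV N → ℂ) : ℝ := ((L2 f) ^ 2 + (L2 (lap f)) ^ 2) ^ ((1 : ℝ)/2)

/-- The potential `∫ |x|^(2b) |f|^(2q)` for the inhomogeneous local problem. -/
def potL {N : ℕ} (b q : ℝ) (f : EV N → ℂ) : ℝ :=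
  ∫ x : EV N, ‖x‖ ^ (2*b) * ‖f x‖ ^ (2*q)

/-- The energy for the inhomogeneous local problem. -/
def energyL {N : ℕ} (b q : ℝ) (f : EV N → ℂ) : ℝ :=
  (L2 (lap f)) ^ 2 - (1/q) * potL b q f

/-- `D := (Nq - N - 2b)/2`. -/
def Dl (N : ℕ) (b q : ℝ) : ℝ := ((N : ℝ)*q - N - 2*b)/2

/-- `E := 2q - D`. -/
def El (N : ℕ) (b q : ℝ) : ℝ := 2*q - Dl N b q

/-- The critical Sobolev index `s_c := N/2 - (2+b)/(q-1)`. -/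
def scL (N : ℕ) (b q : ℝ) : ℝ := (N : ℝ)/2 - (2 + b)/(q - 1)

/-- A ground state for the local problem: a nonzero Schwartz solution of
`Q + Δ²Q - |x|^(2b)|Q|^(2(q-1))Q = 0` satisfying the Pohozaev identities and attaining the
sharp Gagliardo-Nirenberg constant. -/
def IsGroundStateL (N : ℕ) (b q : ℝ) (Q : SchwartzMap (EV N) ℂ) : Prop :=
  Q ≠ 0 ∧
  (∀ x : EV N, x ≠ 0 →
    Q x + lap (lap (⇑Q)) x - ((‖x‖ ^ (2*b) * ‖Q x‖ ^ (2*(q-1)) : ℝ) : ℂ) * Q x = 0) ∧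
  (L2 (lap ⇑Q)) ^ 2 = (Dl N b q / (2*q)) * potL b q ⇑Q ∧
  (L2 ⇑Q) ^ 2 = (El N b q / (2*q)) * potL b q ⇑Q ∧
  (∀ v : SchwartzMap (EV N) ℂ,
    potL b q ⇑v ≤ (2*q / El N b q) * (El N b q / Dl N b q) ^ (Dl N b q / 2)
      * (L2 ⇑Q) ^ (-(2*(q-1))) * (L2 ⇑v) ^ (El N b q) * (L2 (lap ⇑v)) ^ (Dl N b q))

/-- `ME[v] := (E[v]/E[Q])^(s_c) (M[v]/M[Q])^(2-s_c)`. -/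
def MEl {N : ℕ} (b q : ℝ) (Q : SchwartzMap (EV N) ℂ) (v : EV N → ℂ) : ℝ :=
  (energyL b q v / energyL b q ⇑Q) ^ (scL N b q) * (massI v / massI ⇑Q) ^ (2 - scL N b q)

/-- `MG[v] := (‖Δv‖₂/‖ΔQ‖₂)^(s_c) (‖v‖₂/‖Q‖₂)^(2-s_c)`. -/
def MGl {N : ℕ} (b q : ℝ) (Q : SchwartzMap (EV N) ℂ) (v : EV N → ℂ) : ℝ :=
  (L2 (lap v) / L2 (lap ⇑Q)) ^ (scL N b q) * (L2 v / L2 ⇑Q) ^ (2 - scL N b q)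

theorem integral_ball_norm_rpow_neg {N : ℕ} (α : ℝ) {r : ℝ} (hr : 0 < r) :
    ∫ x in Metric.ball (0 : EV N) r, ‖x‖ ^ (-α) =
      r ^ ((N : ℝ) - α) * ∫ x in Metric.ball (0 : EV N) 1, ‖x‖ ^ (-α) := by
  have h := Measure.setIntegral_comp_smul_of_pos (volume : Measure (EV N))
    (fun x => ‖x‖ ^ (-α)) (Metric.ball (0 : EV N) 1) hr
  rw [smul_unitBall hr.ne', finrank_euclideanSpace_fin, Real.norm_of_nonneg hr.le] at h
  simp only [norm_smul, Real.norm_of_nonneg hr.le, smul_eq_mul] at h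
  simp_rw [fun x : EV N => Real.mul_rpow (z := -α) hr.le (norm_nonneg x)] at h
  rw [integral_const_mul] at h
  rw [sub_eq_add_neg, Real.rpow_add hr, Real.rpow_natCast, mul_assoc, h]
  field_simp

theorem integrableOn_ball_norm_rpow_neg {N : ℕ} (hN : 1 ≤ N) {α : ℝ} (hα : α < N) (r : ℝ) :
    IntegrableOn (fun x : EV N => ‖x‖ ^ (-α)) (Metric.ball 0 r) :=
  integrableOn_ball_of_norm_le_rpow (C := 1) (α := α) (by simpa using hN) (by simpa using hα)
    (.of_forall fun x => by
      rw [one_mul, Real.norm_of_nonneg (Real.rpow_nonneg (norm_nonneg x) _)])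
    (measurable_norm.pow_const _).aestronglyMeasurable

/-- The weighted measure `|x|^(-α) dx` of a set is controlled by a power of its volume. -/
theorem exists_setLIntegral_norm_rpow_neg_le {N : ℕ} (hN : 1 ≤ N) {α : ℝ} (hα0 : 0 ≤ α)
    (hα : α < N) :
    ∃ C > 0, ∀ (A : Set (EV N)) (m : ℝ), 0 < m → MeasurableSet A →
      volume A ≤ ENNReal.ofReal m →
      ∫⁻ x in A, ENNReal.ofReal (‖x‖ ^ (-α)) ≤ ENNReal.ofReal (C * m ^ (((N : ℝ) - α) / N)) := by
  have hI : 0 ≤ ∫ x in Metric.ball (0 : EV N) 1, ‖x‖ ^ (-α) :=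
    integral_nonneg fun x => Real.rpow_nonneg (norm_nonneg x) _
  have hN0 : (0 : ℝ) < N := by exact_mod_cast hN
  refine ⟨(∫ x in Metric.ball (0 : EV N) 1, ‖x‖ ^ (-α)) + 1, by linarith, ?_⟩
  intro A m hm hA hAm
  set r : ℝ := m ^ ((1 : ℝ) / N) with hr_def
  have hr : 0 < r := Real.rpow_pos_of_pos hm _
  have hball : ∫⁻ x in Metric.ball (0 : EV N) r, ENNReal.ofReal (‖x‖ ^ (-α)) =
      ENNReal.ofReal (r ^ ((N : ℝ) - α) * ∫ x in Metric.ball (0 : EV N) 1, ‖x‖ ^ (-α)) := by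
    rw [← integral_ball_norm_rpow_neg α hr, ofReal_integral_eq_lintegral_ofReal
      (integrableOn_ball_norm_rpow_neg hN hα r)
      (.of_forall fun x => Real.rpow_nonneg (norm_nonneg x) _)]
  have hout : ∫⁻ x in A \ Metric.ball 0 r, ENNReal.ofReal (‖x‖ ^ (-α)) ≤
      ENNReal.ofReal (r ^ (-α) * m) := by
    calc _ ≤ ∫⁻ x in A \ Metric.ball 0 r, ENNReal.ofReal (r ^ (-α)) := by
          refine setLIntegral_mono' (hA.diff Metric.isOpen_ball.measurableSet) fun x hx => ?_
          have hx' : r ≤ ‖x‖ := by simpa using hx.2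
          exact ENNReal.ofReal_le_ofReal
            (Real.rpow_le_rpow_of_nonpos hr hx' (neg_nonpos.mpr hα0))
      _ ≤ ENNReal.ofReal (r ^ (-α)) * ENNReal.ofReal m := by
          rw [setLIntegral_const]
          gcongr
          exact (measure_mono Set.sdiff_subset).trans hAm
      _ = _ := by rw [ENNReal.ofReal_mul (Real.rpow_nonneg hr.le _)]
  have e1 : r ^ ((N : ℝ) - α) = m ^ (((N : ℝ) - α) / N) := by
    rw [hr_def, ← Real.rpow_mul hm.le]; congr 1; ring
  have e2 : r ^ (-α) * m = m ^ (((N : ℝ) - α) / N) := by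
    rw [hr_def, ← Real.rpow_mul hm.le]
    nth_rewrite 2 [← Real.rpow_one m]
    rw [← Real.rpow_add hm]; congr 1; field_simp; ring
  calc _ ≤ ∫⁻ x in Metric.ball 0 r ∪ (A \ Metric.ball 0 r), ENNReal.ofReal (‖x‖ ^ (-α)) :=
        lintegral_mono_set (by intro x hx; by_cases h : x ∈ Metric.ball 0 r <;> simp_all)
    _ ≤ _ := lintegral_union_le _ _ _
    _ ≤ ENNReal.ofReal (r ^ ((N : ℝ) - α) * ∫ x in Metric.ball (0 : EV N) 1, ‖x‖ ^ (-α))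
        + ENNReal.ofReal (r ^ (-α) * m) := add_le_add hball.le hout
    _ = _ := by
        rw [← ENNReal.ofReal_add (by positivity) (by positivity), e1, e2]; congr 1; ring

open scoped LineDeriv in
theorem lap_eq_laplacian {N : ℕ} (f : SchwartzMap (EV N) ℂ) :
    lap (⇑f) = ⇑(Laplacian.laplacian f : SchwartzMap (EV N) ℂ) := by
  have hpd : ∀ (j : Fin N) (g : SchwartzMap (EV N) ℂ),
      pd j (⇑g) = ⇑(∂_{(EuclideanSpace.single j (1 : ℝ) : EV N)} g : SchwartzMap (EV N) ℂ) := by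
    intro j g
    ext x
    rw [SchwartzMap.lineDerivOp_apply_eq_fderiv]; rfl
  ext x
  rw [SchwartzMap.laplacian_eq_sum (EuclideanSpace.basisFun (Fin N) ℝ)]
  simp [lap, hpd]

theorem fourier_laplacian_apply {N : ℕ} (f : SchwartzMap (EV N) ℂ) (ξ : EV N) :
    𝓕 (Laplacian.laplacian f : SchwartzMap (EV N) ℂ) ξ =
      (-((2 * Real.pi) ^ 2 * ‖ξ‖ ^ 2) : ℝ) • 𝓕 f ξ := by
  rw [SchwartzMap.laplacian_eq_fourierMultiplierCLM, SchwartzMap.fourierMultiplierCLM_apply,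
    ← FourierTransform.fourierInv_smul, FourierTransform.fourier_fourierInv_eq,
    _root_.smul_apply, SchwartzMap.smulLeftCLM_apply_apply (by fun_prop), smul_smul]
  simp

theorem integrable_norm_pow_mul_norm_sq {N : ℕ} (k : ℕ) (g : SchwartzMap (EV N) ℂ) :
    Integrable fun ξ : EV N => ‖ξ‖ ^ k * ‖g ξ‖ ^ 2 := by
  obtain ⟨C, hC⟩ := g.decay 0 0
  have hC' : ∀ x, ‖g x‖ ≤ C := fun x => by simpa using hC.2 x
  refine ((g.integrable_pow_mul volume k).const_mul C).mono' (by fun_prop) (.of_forall fun x => ?_)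
  rw [Real.norm_of_nonneg (by positivity)]
  calc ‖x‖ ^ k * ‖g x‖ ^ 2 = ‖g x‖ * (‖x‖ ^ k * ‖g x‖) := by ring
    _ ≤ C * (‖x‖ ^ k * ‖g x‖) := by gcongr; exact hC' x

theorem massI_lap {N : ℕ} (f : SchwartzMap (EV N) ℂ) :
    massI (lap ⇑f) = (2 * Real.pi) ^ 4 * ∫ ξ : EV N, ‖ξ‖ ^ 4 * ‖𝓕 f ξ‖ ^ 2 := by
  rw [massI, lap_eq_laplacian, ← SchwartzMap.integral_norm_sq_fourier, ← integral_const_mul]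
  congr 1 with ξ
  rw [fourier_laplacian_apply, norm_smul, norm_neg, Real.norm_of_nonneg (by positivity)]
  ring

theorem norm_fourierInv_apply_le {N : ℕ} (h : SchwartzMap (EV N) ℂ) (x : EV N) :
    ‖(𝓕⁻ h : SchwartzMap (EV N) ℂ) x‖ ≤ ∫ ξ, ‖h ξ‖ := by
  rw [SchwartzMap.fourierInv_coe, Real.fourierInv_eq]
  refine (norm_integral_le_integral_norm _).trans (le_of_eq ?_)
  simp

/-- Chebyshev's inequality for Schwartz functions. -/
theorem volume_lt_norm_le {N : ℕ} (f : SchwartzMap (EV N) ℂ) {s : ℝ} (hs : 0 < s) :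
    volume {x | s ≤ ‖f x‖} ≤ ENNReal.ofReal ((∫ x, ‖f x‖ ^ 2) / s ^ 2) := by
  have hint : Integrable fun x => ‖f x‖ ^ 2 := by
    simpa using integrable_norm_pow_mul_norm_sq 0 f
  have h := mul_meas_ge_le_lintegral₀ (μ := (volume : Measure (EV N)))
    (f := fun x => ENNReal.ofReal (‖f x‖ ^ 2)) (by fun_prop) (ENNReal.ofReal (s ^ 2))
  rw [← ofReal_integral_eq_lintegral_ofReal hint (.of_forall fun x => by positivity)] at h
  rw [ENNReal.ofReal_div_of_pos (by positivity), ENNReal.le_div_iff_mul_le (.inl (by simp [hs.ne'])) (by simp),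
    mul_comm]
  refine le_trans ?_ h
  gcongr with x
  intro hx
  exact ENNReal.ofReal_le_ofReal (by gcongr)

theorem rpow_le_rpow_mul_one_add {σ x ρ : ℝ} (hσ0 : 0 ≤ σ) (hσ4 : σ ≤ 4) (hx : 0 ≤ x)
    (hρ : 0 < ρ) : x ^ σ ≤ ρ ^ σ * (1 + x ^ 4 / ρ ^ 4) := by
  have key : (x / ρ) ^ σ ≤ 1 + (x / ρ) ^ 4 := by
    have h0 : 0 ≤ x / ρ := by positivity
    rcases le_total (x / ρ) 1 with h | h
    · have := Real.rpow_le_one h0 h hσ0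
      have : 0 ≤ (x / ρ) ^ 4 := by positivity
      linarith
    · have := Real.rpow_le_rpow_of_exponent_le h hσ4
      have e : (x / ρ) ^ (4 : ℝ) = (x / ρ) ^ 4 := by
        rw [← Real.rpow_natCast]; norm_num
      rw [e] at this
      linarith
  rw [Real.div_rpow hx hρ.le, div_pow, div_le_iff₀ (by positivity)] at key
  linarith

/-- The `L¹` norm of a function dominated by the restriction of `g` to a ball, in terms of
`∫ |g|²` and `∫ |ξ|⁴ |g|²`. -/
theorem integral_norm_le_of_norm_le_indicator {N : ℕ} (hN : 1 ≤ N) {σ : ℝ} (hσ0 : 0 ≤ σ)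
    (hσ4 : σ ≤ 4) (hσN : σ < N) {r ε ρ : ℝ} (hr : 0 < r) (hε : 0 < ε) (hρ : 0 < ρ)
    (g h : SchwartzMap (EV N) ℂ)
    (hle : ∀ ξ, ‖h ξ‖ ≤ (Metric.ball (0 : EV N) r).indicator (fun ξ => ‖g ξ‖) ξ) :
    ∫ ξ, ‖h ξ‖ ≤ ε / 2 * (r ^ ((N : ℝ) - σ) * ∫ x in Metric.ball (0 : EV N) 1, ‖x‖ ^ (-σ))
      + ρ ^ σ / (2 * ε) * ((∫ ξ, ‖g ξ‖ ^ 2) + (∫ ξ, ‖ξ‖ ^ 4 * ‖g ξ‖ ^ 2) / ρ ^ 4) := by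
  have i0 : Integrable fun ξ => ‖g ξ‖ ^ 2 := by
    simpa using integrable_norm_pow_mul_norm_sq 0 g
  have i4 := integrable_norm_pow_mul_norm_sq 4 g
  have iw : Integrable ((Metric.ball (0 : EV N) r).indicator fun x => ‖x‖ ^ (-σ)) :=
    (integrableOn_ball_norm_rpow_neg hN hσN r).integrable_indicator
      Metric.isOpen_ball.measurableSet
  have i2 : Integrable fun ξ =>
      ρ ^ σ / (2 * ε) * (‖g ξ‖ ^ 2 + ‖ξ‖ ^ 4 * ‖g ξ‖ ^ 2 / ρ ^ 4) :=
    (i0.add (i4.div_const _)).const_mul _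
  have : Nonempty (Fin N) := ⟨⟨0, hN⟩⟩
  rw [← integral_ball_norm_rpow_neg σ hr, ← integral_indicator Metric.isOpen_ball.measurableSet,
    ← integral_div, ← integral_add i0 (i4.div_const _), ← integral_const_mul,
    ← integral_const_mul, ← integral_add (iw.const_mul _) i2]
  refine integral_mono_ae h.integrable.norm
    ((iw.const_mul _).add i2) ?_
  filter_upwards [compl_mem_ae_iff.mpr (measure_singleton (0 : EV N))] with ξ hξ
  have hξ0 : 0 < ‖ξ‖ := norm_pos_iff.mpr hξ
  refine (hle ξ).trans ?_
  by_cases hb : ξ ∈ Metric.ball (0 : EV N) r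
  · simp only [Set.indicator_of_mem hb]
    have hp : 0 < ‖ξ‖ ^ σ := Real.rpow_pos_of_pos hξ0 σ
    have h1 := rpow_le_rpow_mul_one_add hσ0 hσ4 hξ0.le hρ
    have h2 : ‖g ξ‖ ≤ ε / 2 * ‖ξ‖ ^ (-σ) + 1 / (2 * ε) * (‖ξ‖ ^ σ * ‖g ξ‖ ^ 2) := by
      rw [Real.rpow_neg hξ0.le]
      have h3 : ε / 2 * (‖ξ‖ ^ σ)⁻¹ + 1 / (2 * ε) * (‖ξ‖ ^ σ * ‖g ξ‖ ^ 2) - ‖g ξ‖ =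
          (ε - ‖ξ‖ ^ σ * ‖g ξ‖) ^ 2 / (2 * ε * ‖ξ‖ ^ σ) := by field_simp; ring
      have h4 : 0 ≤ (ε - ‖ξ‖ ^ σ * ‖g ξ‖) ^ 2 / (2 * ε * ‖ξ‖ ^ σ) := by positivity
      linarith
    refine h2.trans (add_le_add le_rfl ?_)
    calc 1 / (2 * ε) * (‖ξ‖ ^ σ * ‖g ξ‖ ^ 2)
        ≤ 1 / (2 * ε) * (ρ ^ σ * (1 + ‖ξ‖ ^ 4 / ρ ^ 4) * ‖g ξ‖ ^ 2) := by gcongr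
      _ = _ := by ring
  · simp only [Set.indicator_of_notMem hb, mul_zero, zero_add]
    positivity

/-- Splitting a Schwartz function by a smooth frequency cutoff at radius `R`: the low part is
bounded by the integral of a function dominated by `𝓕 f` on the ball of radius `2 R`, and the high
part is small in `L²`. -/
theorem exists_frequency_splitting {N : ℕ} (f : SchwartzMap (EV N) ℂ) {R : ℝ} (hR : 0 < R) :
    ∃ h fh : SchwartzMap (EV N) ℂ,
      (∀ ξ, ‖h ξ‖ ≤ (Metric.ball (0 : EV N) (2 * R)).indicator (fun ξ => ‖𝓕 f ξ‖) ξ) ∧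
      (∀ x, ‖f x‖ ≤ (∫ ξ, ‖h ξ‖) + ‖fh x‖) ∧
      ∫ x, ‖fh x‖ ^ 2 ≤ (∫ ξ, ‖ξ‖ ^ 4 * ‖𝓕 f ξ‖ ^ 2) / R ^ 4 := by
  let χ : ContDiffBump (0 : EV N) := ⟨R, 2 * R, hR, by linarith⟩
  have hχ : (fun x => χ x).HasTemperateGrowth :=
    χ.hasCompactSupport.hasTemperateGrowth χ.contDiff
  let h : SchwartzMap (EV N) ℂ := SchwartzMap.smulLeftCLM ℂ (fun x => χ x) (𝓕 f)
  have happ : ∀ ξ, h ξ = χ ξ • 𝓕 f ξ := fun ξ => SchwartzMap.smulLeftCLM_apply_apply hχ _ ξ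
  refine ⟨h, f - 𝓕⁻ h, fun ξ => ?_, fun x => ?_, ?_⟩
  · by_cases hb : ξ ∈ Metric.ball (0 : EV N) (2 * R)
    · rw [Set.indicator_of_mem hb, happ, norm_smul, Real.norm_of_nonneg χ.nonneg]
      exact mul_le_of_le_one_left (norm_nonneg _) χ.le_one
    · have : χ ξ = 0 := χ.zero_of_le_dist (by simpa using hb)
      simp [Set.indicator_of_notMem hb, happ, this]
  · calc ‖f x‖ = ‖(𝓕⁻ h : SchwartzMap (EV N) ℂ) x
          + (f - 𝓕⁻ h : SchwartzMap (EV N) ℂ) x‖ := by simp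
      _ ≤ _ := (norm_add_le _ _).trans (add_le_add (norm_fourierInv_apply_le h x) le_rfl)
  · rw [← SchwartzMap.integral_norm_sq_fourier, ← integral_div]
    refine integral_mono (by simpa using
      integrable_norm_pow_mul_norm_sq 0 (𝓕 (f - 𝓕⁻ h) : SchwartzMap (EV N) ℂ))
      ((integrable_norm_pow_mul_norm_sq 4 (𝓕 f)).div_const _) fun ξ => ?_
    have e : 𝓕 (f - 𝓕⁻ h : SchwartzMap (EV N) ℂ) ξ = (1 - χ ξ) • 𝓕 f ξ := by
      rw [sub_eq_add_neg, FourierTransform.fourier_add, FourierTransform.fourier_neg,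
        FourierTransform.fourier_fourierInv_eq]
      simp [happ, sub_eq_add_neg, add_mul]
    simp only [e]
    by_cases hb : ‖ξ‖ ≤ R
    · have : χ ξ = 1 := χ.one_of_mem_closedBall (by simpa using hb)
      rw [this]
      simp only [sub_self, zero_smul, norm_zero, ne_eq, OfNat.ofNat_ne_zero, not_false_eq_true,
        zero_pow]
      positivity
    · have hb' : R ≤ ‖ξ‖ := (not_le.mp hb).le
      have h1 : ‖(1 - χ ξ) • 𝓕 f ξ‖ ≤ ‖𝓕 f ξ‖ := by
        rw [norm_smul]
        refine mul_le_of_le_one_left (norm_nonneg _) ?_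
        rw [Real.norm_of_nonneg (sub_nonneg.mpr χ.le_one)]
        linarith [χ.nonneg (x := ξ)]
      rw [le_div_iff₀ (by positivity), mul_comm]
      gcongr

/-- Weak-type Sobolev inequality, in scale-invariant form. -/
theorem exists_volume_lt_norm_le {N : ℕ} (hN : 1 ≤ N) {σ : ℝ} (hσ0 : 0 ≤ σ)
    (hσ4 : σ ≤ 4) (hσN : σ < N) :
    ∃ K > 0, ∀ (f : SchwartzMap (EV N) ℂ) (M ρ t : ℝ), 0 < M → 0 < ρ → 0 < t →
      ∫ x, ‖f x‖ ^ 2 = M ^ 2 → ∫ ξ, ‖ξ‖ ^ 4 * ‖𝓕 f ξ‖ ^ 2 ≤ ρ ^ 4 * M ^ 2 →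
      volume {x | M * ρ ^ ((N : ℝ) / 2) * t < ‖f x‖} ≤
        ENNReal.ofReal (K * (ρ ^ (-(N : ℝ)) * t ^ (-(2 + 8 / ((N : ℝ) - σ))))) := by
  set I := ∫ x in Metric.ball (0 : EV N) 1, ‖x‖ ^ (-σ) with hI_def
  have hI : 0 ≤ I := integral_nonneg fun x => Real.rpow_nonneg (norm_nonneg x) _
  have hd : 0 < (N : ℝ) - σ := sub_pos.mpr hσN
  set c : ℝ := (1 / (16 * (I + 1))) ^ (1 / ((N : ℝ) - σ)) / 2 with hc_def
  have hc : 0 < c := by positivity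
  have hc2 : (2 * c) ^ ((N : ℝ) - σ) = 1 / (16 * (I + 1)) := by
    rw [hc_def, mul_div_cancel₀ _ two_ne_zero, ← Real.rpow_mul (by positivity),
      one_div_mul_cancel hd.ne', Real.rpow_one]
  refine ⟨4 / c ^ 4, by positivity, fun f M ρ t hM hρ ht hfM hfρ => ?_⟩
  set τ : ℝ := t ^ (2 / ((N : ℝ) - σ)) with hτ_def
  have hτ : 0 < τ := by positivity
  have hτ2 : τ ^ ((N : ℝ) - σ) = t ^ 2 := by
    rw [hτ_def, ← Real.rpow_mul ht.le, div_mul_cancel₀ _ hd.ne', Real.rpow_two]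
  have hR : 0 < c * ρ * τ := by positivity
  obtain ⟨h, fh, hle, hsplit, hhigh⟩ := exists_frequency_splitting f hR
  set P : ℝ := ρ ^ ((N : ℝ) / 2) with hP_def
  have hP : 0 < P := by positivity
  have hPN : P ^ 2 = ρ ^ (N : ℝ) := by
    rw [hP_def, ← Real.rpow_natCast, ← Real.rpow_mul hρ.le]; congr 1; push_cast; ring
  have hρσ : ρ ^ ((N : ℝ) - σ) * ρ ^ σ = P ^ 2 := by
    rw [hPN, ← Real.rpow_add hρ]; congr 1; ring
  set Q := ρ ^ σ with hQ_def
  have hQ : 0 < Q := by positivity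
  set S := ρ ^ ((N : ℝ) - σ) with hS_def
  have hlow : ∫ ξ, ‖h ξ‖ ≤ M * P * t / 2 := by
    have h1 := integral_norm_le_of_norm_le_indicator hN hσ0 hσ4 hσN (r := 2 * (c * ρ * τ))
      (ε := 8 * M * Q / (P * t)) (ρ := ρ) (by positivity) (by positivity) hρ (𝓕 f) h hle
    rw [SchwartzMap.integral_norm_sq_fourier, hfM, ← hI_def, ← hQ_def] at h1
    have h2 : (2 * (c * ρ * τ)) ^ ((N : ℝ) - σ) = 1 / (16 * (I + 1)) * S * t ^ 2 := by
      rw [show 2 * (c * ρ * τ) = (2 * c) * ρ * τ by ring, Real.mul_rpow (by positivity) hτ.le,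
        Real.mul_rpow (by positivity) hρ.le, hc2, hτ2]
    have h3 : (∫ ξ, ‖ξ‖ ^ 4 * ‖𝓕 f ξ‖ ^ 2) / ρ ^ 4 ≤ M ^ 2 := by
      rw [div_le_iff₀ (by positivity)]; linarith
    have h4 : 8 * M * Q / (P * t) / 2 * (1 / (16 * (I + 1)) * S * t ^ 2 * I) ≤
        M * P * t / 4 := by
      have : 8 * M * Q / (P * t) / 2 * (1 / (16 * (I + 1)) * S * t ^ 2 * I) =
          M * t / P * (S * Q) / 4 * (I / (I + 1)) := by field_simp; ring
      rw [this, hρσ]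
      have h5 : I / (I + 1) ≤ 1 := by rw [div_le_one (by positivity)]; linarith
      calc _ ≤ M * t / P * P ^ 2 / 4 * 1 := by gcongr
        _ = _ := by field_simp
    calc _ ≤ _ := h1
      _ ≤ M * P * t / 4 + Q / (2 * (8 * M * Q / (P * t))) * (M ^ 2 + M ^ 2) := by
          rw [h2]
          exact add_le_add h4 (mul_le_mul_of_nonneg_left (by linarith) (by positivity))
      _ = M * P * t * (3 / 8) := by field_simp; ring
      _ ≤ _ := by nlinarith [show 0 < M * P * t by positivity]
  have hsub : {x | M * P * t < ‖f x‖} ⊆ {x | M * P * t / 2 ≤ ‖fh x‖} := by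
    intro x hx
    have := hsplit x
    simp only [Set.mem_ofPred_eq] at hx ⊢
    linarith
  refine (measure_mono hsub).trans ((volume_lt_norm_le fh (by positivity)).trans
    (ENNReal.ofReal_le_ofReal ?_))
  have hexp : t ^ (-(2 + 8 / ((N : ℝ) - σ))) = (t ^ 2 * τ ^ 4)⁻¹ := by
    rw [Real.rpow_neg ht.le, Real.rpow_add ht, Real.rpow_two, hτ_def,
      ← Real.rpow_natCast (t ^ _) 4, ← Real.rpow_mul ht.le]
    congr 3; push_cast; ring
  rw [hexp, Real.rpow_neg hρ.le, ← hPN]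
  calc (∫ x, ‖fh x‖ ^ 2) / (M * P * t / 2) ^ 2
      ≤ (ρ ^ 4 * M ^ 2 / (c * ρ * τ) ^ 4) / (M * P * t / 2) ^ 2 := by
        gcongr; exact hhigh.trans (by gcongr)
    _ = _ := by field_simp; ring

theorem setLIntegral_le_of_le_rpow {S : Set ℝ} (hS : MeasurableSet S) (hS0 : S ⊆ Set.Ioi 0)
    {s B : ℝ} (hB : 0 ≤ B) (hint : IntegrableOn (fun t : ℝ => t ^ s) S) {F : ℝ → ℝ≥0∞}
    (hF : ∀ t ∈ S, F t ≤ ENNReal.ofReal (B * t ^ s)) :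
    ∫⁻ t in S, F t ≤ ENNReal.ofReal (B * ∫ t in S, t ^ s) := by
  rw [← integral_const_mul, ofReal_integral_eq_lintegral_ofReal (hint.const_mul B)]
  · exact setLIntegral_mono' hS hF
  · filter_upwards [ae_restrict_mem hS] with t ht
    exact mul_nonneg hB (Real.rpow_nonneg (hS0 ht).le _)

/-- The weighted Gagliardo-Nirenberg inequality in terms of `M = ‖f‖₂` and a frequency scale
`ρ`. -/
theorem exists_lintegral_weight_le {N : ℕ} (hN : 1 ≤ N) {σ a q : ℝ} (hσ0 : 0 ≤ σ)
    (hσ4 : σ ≤ 4) (hσN : σ < N) (ha0 : 0 ≤ a) (haN : a < N) (hq : 1 < q)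
    (hqσ : q < ((N : ℝ) - a) / N * (1 + 4 / ((N : ℝ) - σ))) :
    ∃ C > 0, ∀ (f : SchwartzMap (EV N) ℂ) (M ρ : ℝ), 0 < M → 0 < ρ →
      ∫ x, ‖f x‖ ^ 2 = M ^ 2 → ∫ ξ, ‖ξ‖ ^ 4 * ‖𝓕 f ξ‖ ^ 2 ≤ ρ ^ 4 * M ^ 2 →
      ∫⁻ x, ENNReal.ofReal (‖x‖ ^ (-a) * ‖f x‖ ^ (2 * q)) ≤
        ENNReal.ofReal (C * ((M * ρ ^ ((N : ℝ) / 2)) ^ (2 * q) * ρ ^ (-((N : ℝ) - a)))) := by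
  obtain ⟨K, hK, hweak⟩ := exists_volume_lt_norm_le hN hσ0 hσ4 hσN
  obtain ⟨C, hC, hweight⟩ := exists_setLIntegral_norm_rpow_neg_le hN ha0 haN
  have hN0 : (0 : ℝ) < N := by exact_mod_cast hN
  set θ : ℝ := ((N : ℝ) - a) / N with hθ_def
  set p : ℝ := 2 + 8 / ((N : ℝ) - σ) with hp_def
  have hθ1 : θ ≤ 1 := by rw [hθ_def, div_le_one hN0]; linarith
  have hpθ : 2 * q < p * θ := by
    have : p * θ = 2 * (θ * (1 + 4 / ((N : ℝ) - σ))) := by rw [hp_def]; ring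
    linarith
  have i1 : IntegrableOn (fun t : ℝ => t ^ (2 * q - 1 - 2 * θ)) (Set.Ioc 0 1) :=
    (intervalIntegral.intervalIntegrable_rpow' (a := 0) (b := 1) (by linarith)).1
  have i2 : IntegrableOn (fun t : ℝ => t ^ (2 * q - 1 - p * θ)) (Set.Ioi 1) :=
    integrableOn_Ioi_rpow_of_lt (by linarith) one_pos
  set J₁ := ∫ t in Set.Ioc (0 : ℝ) 1, t ^ (2 * q - 1 - 2 * θ) with hJ₁_def
  set J₂ := ∫ t in Set.Ioi (1 : ℝ), t ^ (2 * q - 1 - p * θ) with hJ₂_def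
  have hJ₁ : 0 ≤ J₁ := setIntegral_nonneg measurableSet_Ioc fun t ht => Real.rpow_nonneg ht.1.le _
  have hJ₂ : 0 ≤ J₂ := setIntegral_nonneg measurableSet_Ioi fun t ht =>
    Real.rpow_nonneg (zero_le_one.trans (le_of_lt ht)) _
  refine ⟨2 * q * (C * (J₁ + K ^ θ * J₂)) + 1, by positivity, fun f M ρ hM hρ hfM hfρ => ?_⟩
  set l : ℝ := M * ρ ^ ((N : ℝ) / 2) with hl_def
  have hl : 0 < l := by positivity
  set μ : Measure (EV N) := volume.withDensity fun x => ENNReal.ofReal (‖x‖ ^ (-a)) with hμ_def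
  have hw : Measurable fun x : EV N => ENNReal.ofReal (‖x‖ ^ (-a)) :=
    (measurable_norm.pow_const _).ennreal_ofReal
  have hf : Measurable fun x : EV N => ‖f x‖ / l := by fun_prop
  have hscale : ∫⁻ x, ENNReal.ofReal (‖x‖ ^ (-a) * ‖f x‖ ^ (2 * q)) =
      ENNReal.ofReal (l ^ (2 * q)) * ∫⁻ x, ENNReal.ofReal ((‖f x‖ / l) ^ (2 * q)) ∂μ := by
    have hm : Measurable fun x : EV N => ENNReal.ofReal ((‖f x‖ / l) ^ (2 * q)) :=
      (hf.pow_const _).ennreal_ofReal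
    rw [hμ_def, lintegral_withDensity_eq_lintegral_mul _ hw hm,
      ← lintegral_const_mul _ (hw.mul hm)]
    refine lintegral_congr fun x => ?_
    simp only [Pi.mul_apply]
    rw [← ENNReal.ofReal_mul (by positivity), ← ENNReal.ofReal_mul (by positivity),
      Real.div_rpow (norm_nonneg _) hl.le]
    congr 1
    field_simp
  have hA : ∀ t : ℝ, {x : EV N | t < ‖f x‖ / l} = {x | l * t < ‖f x‖} := fun t => by
    ext x
    simp only [Set.mem_ofPred_eq, lt_div_iff₀ hl, mul_comm]
  have hbound : ∀ t m : ℝ, 0 < m → volume {x | l * t < ‖f x‖} ≤ ENNReal.ofReal m →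
      μ {x | t < ‖f x‖ / l} ≤ ENNReal.ofReal (C * m ^ θ) := by
    intro t m hm hle
    have hmeas : MeasurableSet {x : EV N | l * t < ‖f x‖} :=
      measurableSet_lt measurable_const (by fun_prop)
    rw [hA, hμ_def, withDensity_apply _ hmeas]
    exact hweight _ m hm hmeas hle
  set W := ρ ^ (-((N : ℝ) - a)) with hW_def
  have hW : 0 < W := by positivity
  have hρθ : (ρ ^ (-(N : ℝ))) ^ θ = W := by
    rw [← Real.rpow_mul hρ.le, hW_def, hθ_def]; congr 1; field_simp
  have h₁ : ∀ t ∈ Set.Ioc (0 : ℝ) 1, μ {x | t < ‖f x‖ / l} * ENNReal.ofReal (t ^ (2 * q - 1)) ≤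
      ENNReal.ofReal (C * W * t ^ (2 * q - 1 - 2 * θ)) := by
    intro t ht
    have ht0 : 0 < t := ht.1
    have hcheb : volume {x | l * t < ‖f x‖} ≤ ENNReal.ofReal (ρ ^ (-(N : ℝ)) * t ^ (-2 : ℝ)) := by
      refine (measure_mono fun x (hx : l * t < ‖f x‖) => hx.le).trans
        ((volume_lt_norm_le f (mul_pos hl ht0)).trans (le_of_eq ?_))
      rw [hfM, hl_def, Real.rpow_neg hρ.le, Real.rpow_neg ht0.le, Real.rpow_two]
      have : (ρ ^ ((N : ℝ) / 2)) ^ 2 = ρ ^ (N : ℝ) := by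
        rw [← Real.rpow_natCast, ← Real.rpow_mul hρ.le]; congr 1; push_cast; ring
      rw [← this]
      congr 1
      field_simp
    calc _ ≤ ENNReal.ofReal (C * (ρ ^ (-(N : ℝ)) * t ^ (-2 : ℝ)) ^ θ) *
          ENNReal.ofReal (t ^ (2 * q - 1)) := by
          gcongr; exact hbound t _ (by positivity) hcheb
      _ = _ := by
          rw [← ENNReal.ofReal_mul (by positivity), Real.mul_rpow (by positivity) (by positivity),
            hρθ, ← Real.rpow_mul ht0.le, Real.rpow_sub ht0 (2 * q - 1), neg_mul, Real.rpow_neg ht0.le]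
          congr 1
          field_simp
  have h₂ : ∀ t ∈ Set.Ioi (1 : ℝ), μ {x | t < ‖f x‖ / l} * ENNReal.ofReal (t ^ (2 * q - 1)) ≤
      ENNReal.ofReal (C * W * K ^ θ * t ^ (2 * q - 1 - p * θ)) := by
    intro t ht
    have ht0 : 0 < t := zero_lt_one.trans ht
    calc _ ≤ ENNReal.ofReal (C * (K * (ρ ^ (-(N : ℝ)) * t ^ (-p))) ^ θ) *
          ENNReal.ofReal (t ^ (2 * q - 1)) := by
          gcongr; exact hbound t _ (by positivity) (hweak f M ρ t hM hρ ht0 hfM hfρ)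
      _ = _ := by
          rw [← ENNReal.ofReal_mul (by positivity), Real.mul_rpow hK.le (by positivity),
            Real.mul_rpow (by positivity) (by positivity),
            hρθ, ← Real.rpow_mul ht0.le, Real.rpow_sub ht0 (2 * q - 1), neg_mul, Real.rpow_neg ht0.le]
          congr 1
          field_simp
  rw [hscale, lintegral_rpow_eq_lintegral_meas_lt_mul μ (.of_forall fun x => by positivity)
    hf.aemeasurable (by positivity), ← Set.Ioc_union_Ioi_eq_Ioi (zero_le_one' ℝ)]
  calc _ ≤ ENNReal.ofReal (l ^ (2 * q)) * (ENNReal.ofReal (2 * q) *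
        (ENNReal.ofReal (C * W * J₁) + ENNReal.ofReal (C * W * K ^ θ * J₂))) := by
        gcongr
        exact (lintegral_union_le _ _ _).trans (add_le_add
          (setLIntegral_le_of_le_rpow measurableSet_Ioc (fun t ht => ht.1) (by positivity) i1 h₁)
          (setLIntegral_le_of_le_rpow measurableSet_Ioi (Set.Ioi_subset_Ioi zero_le_one)
            (by positivity) i2 h₂))
    _ = ENNReal.ofReal (2 * q * (C * (J₁ + K ^ θ * J₂)) * (l ^ (2 * q) * W)) := by
        rw [← ENNReal.ofReal_add (by positivity) (by positivity),
          ← ENNReal.ofReal_mul (by positivity), ← ENNReal.ofReal_mul (by positivity)]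
        congr 1; ring
    _ ≤ _ := by
        apply ENNReal.ofReal_le_ofReal
        gcongr
        linarith

/-- A frequency exponent admissible for the weighted Gagliardo-Nirenberg inequality. -/
theorem exists_admissible_exponent {N : ℕ} (hN : 1 ≤ N) {b q : ℝ}
    (hb : max (-4) (-(N : ℝ)) < 2 * b) (hb' : 2 * b < 0)
    (hq : 1 < q) (hq' : 5 ≤ N → q < 1 + (4 + 2 * b) / ((N : ℝ) - 4)) :
    ∃ σ : ℝ, 0 ≤ σ ∧ σ ≤ 4 ∧ σ < N ∧
      q < ((N : ℝ) - (-(2 * b))) / N * (1 + 4 / ((N : ℝ) - σ)) := by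
  have hN0 : (0 : ℝ) < N := by exact_mod_cast hN
  obtain ⟨hb4, hbN⟩ := max_lt_iff.mp hb
  have hq0 : 0 < q := by linarith
  have hsub : (N : ℝ) - (N + 2 * b) / q < 4 := by
    have : ((N : ℝ) - 4) * q < N + 2 * b := by
      by_cases h5 : 5 ≤ N
      · have h5' : (5 : ℝ) ≤ N := by exact_mod_cast h5
        have h := hq' h5
        have hpos : (0 : ℝ) < (N : ℝ) - 4 := by linarith
        have h2 : q - 1 < (4 + 2 * b) / ((N : ℝ) - 4) := by linarith
        rw [lt_div_iff₀ hpos] at h2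
        linarith
      · have h4 : (N : ℝ) ≤ 4 := by exact_mod_cast (by omega : N ≤ 4)
        nlinarith
    have : (N : ℝ) - 4 < (N + 2 * b) / q := by rwa [lt_div_iff₀ hq0]
    linarith
  have hsubN : (N : ℝ) - (N + 2 * b) / q < N := by
    have : 0 < ((N : ℝ) + 2 * b) / q := div_pos (by linarith) hq0
    linarith
  obtain ⟨σ, hσ1, hσ2⟩ := exists_between (lt_min hsub hsubN)
  obtain ⟨hσ4, hσN⟩ := lt_min_iff.mp hσ2
  have hpos : 0 < (N : ℝ) - (N + 2 * b) / q := by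
    rw [sub_pos, div_lt_iff₀ hq0]
    nlinarith
  have hd : 0 < (N : ℝ) - σ := sub_pos.mpr hσN
  refine ⟨σ, by linarith, hσ4.le, hσN, ?_⟩
  have h1 : ((N : ℝ) - σ) * q < N + 2 * b := by
    rw [← lt_div_iff₀ hq0]; linarith
  have h2 : (N : ℝ) / (N - σ) ≤ 1 + 4 / (N - σ) := by
    rw [div_le_iff₀ hd, add_mul, div_mul_cancel₀ _ hd.ne']; linarith
  calc q < (N + 2 * b) / (N - σ) := by rw [lt_div_iff₀ hd]; linarith
    _ = ((N : ℝ) - (-(2 * b))) / N * (N / (N - σ)) := by field_simp; ring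
    _ ≤ _ := mul_le_mul_of_nonneg_left h2 (div_nonneg (by linarith) hN0.le)

theorem L2_sq {N : ℕ} (f : EV N → ℂ) : L2 f ^ 2 = massI f := by
  have : 0 ≤ massI f := integral_nonneg fun x => by positivity
  rw [L2, ← Real.sqrt_eq_rpow, Real.sq_sqrt this]

theorem L2_nonneg {N : ℕ} (f : EV N → ℂ) : 0 ≤ L2 f :=
  Real.rpow_nonneg (integral_nonneg fun x => by positivity) _

theorem ae_eq_zero_of_L2_eq_zero {N : ℕ} (f : SchwartzMap (EV N) ℂ) (h : L2 ⇑f = 0) :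
    ∀ᵐ x, f x = 0 := by
  have h0 : ∫ x, ‖f x‖ ^ 2 = 0 := by
    have := L2_sq (⇑f)
    rw [h, zero_pow two_ne_zero] at this
    exact this.symm
  rw [integral_eq_zero_iff_of_nonneg (fun x => by positivity)
    (by simpa using integrable_norm_pow_mul_norm_sq 0 f)] at h0
  filter_upwards [h0] with x hx
  simpa using hx

theorem L2_eq_zero_of_L2_lap_eq_zero {N : ℕ} (hN : 1 ≤ N) (f : SchwartzMap (EV N) ℂ)
    (h : L2 (lap ⇑f) = 0) : L2 ⇑f = 0 := by
  have : Nonempty (Fin N) := ⟨⟨0, hN⟩⟩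
  have h0 : ∫ ξ : EV N, ‖ξ‖ ^ 4 * ‖𝓕 f ξ‖ ^ 2 = 0 := by
    have := L2_sq (lap ⇑f)
    rw [h, massI_lap, zero_pow two_ne_zero] at this
    exact (mul_eq_zero.mp this.symm).resolve_left (by positivity)
  rw [integral_eq_zero_iff_of_nonneg (fun x => by positivity)
    (integrable_norm_pow_mul_norm_sq 4 _)] at h0
  have hz : ∫ ξ : EV N, ‖𝓕 f ξ‖ ^ 2 = 0 := by
    refine integral_eq_zero_of_ae ?_
    filter_upwards [h0, compl_mem_ae_iff.mpr (measure_singleton (0 : EV N))] with ξ hξ hξ0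
    have hξ0' : ξ ≠ 0 := hξ0
    simpa [hξ0'] using hξ
  rw [SchwartzMap.integral_norm_sq_fourier] at hz
  rw [L2, massI, hz, Real.zero_rpow (by norm_num)]

/-- **Gagliardo-Nirenberg inequality (local source term).**
For `N ≥ 1`, `max{-4, -N} < 2b < 0` and `1 < q < q^*`, there is `C = C(N,q,b) > 0` with
`∫|x|^(2b)|v|^(2q) ≤ C ‖v‖₂^E ‖Δv‖₂^D` for every Schwartz `v`. -/
theorem stmt16 (N : ℕ) (hN : 1 ≤ N) (b q : ℝ)
    (hb : max (-4) (-(N : ℝ)) < 2*b) (hb' : 2*b < 0)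
    (hq : 1 < q) (hq' : 5 ≤ N → q < 1 + (4 + 2*b)/((N : ℝ) - 4)) :
    ∃ C > 0, ∀ v : SchwartzMap (EV N) ℂ,
      potL b q ⇑v ≤ C * (L2 ⇑v) ^ (El N b q) * (L2 (lap ⇑v)) ^ (Dl N b q) := by
  obtain ⟨σ, hσ0, hσ4, hσN, hqσ⟩ := exists_admissible_exponent hN hb hb' hq hq'
  obtain ⟨-, hbN⟩ := max_lt_iff.mp hb
  obtain ⟨C, hC, hmain⟩ := exists_lintegral_weight_le hN hσ0 hσ4 hσN
    (a := -(2 * b)) (by linarith) (by linarith) hq hqσ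
  refine ⟨C, hC, fun v => ?_⟩
  have hM0 := L2_nonneg (⇑v)
  have hL0 := L2_nonneg (lap ⇑v)
  rcases hM0.eq_or_lt with hM | hM
  · have hpot : potL b q ⇑v = 0 := by
      refine integral_eq_zero_of_ae ?_
      filter_upwards [ae_eq_zero_of_L2_eq_zero v hM.symm] with x hx
      rw [hx, norm_zero, Real.zero_rpow (by positivity), mul_zero, Pi.zero_apply]
    rw [hpot]
    positivity
  have hL : 0 < L2 (lap ⇑v) := hL0.lt_of_ne' fun h =>
    hM.ne' (L2_eq_zero_of_L2_lap_eq_zero hN v h)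
  set M := L2 ⇑v with hM_def
  set L := L2 (lap ⇑v) with hL_def
  set ρ : ℝ := (L / M) ^ ((1 : ℝ) / 2) with hρ_def
  have hρ : 0 < ρ := by positivity
  have hρ4 : ρ ^ 4 * M ^ 2 = L ^ 2 := by
    have : ρ ^ 2 = L / M := by
      rw [hρ_def, ← Real.sqrt_eq_rpow, Real.sq_sqrt (by positivity)]
    rw [show ρ ^ 4 = (ρ ^ 2) ^ 2 by ring, this]
    field_simp
  have hfour : ∫ ξ, ‖ξ‖ ^ 4 * ‖𝓕 v ξ‖ ^ 2 ≤ ρ ^ 4 * M ^ 2 := by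
    rw [hρ4, hL_def, L2_sq, massI_lap]
    refine le_mul_of_one_le_left (integral_nonneg fun ξ => by positivity) ?_
    exact one_le_pow₀ (by linarith [Real.pi_gt_three])
  have h := hmain v M ρ hM hρ (L2_sq _).symm hfour
  rw [neg_neg] at h
  have hpot : potL b q ⇑v ≤
      C * ((M * ρ ^ ((N : ℝ) / 2)) ^ (2 * q) * ρ ^ (-((N : ℝ) - -(2 * b)))) := by
    have hmeas : Measurable fun x : EV N => ‖x‖ ^ (2 * b) * ‖v x‖ ^ (2 * q) :=
      (measurable_norm.pow_const _).mul (v.continuous.measurable.norm.pow_const _)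
    rw [potL, integral_eq_lintegral_of_nonneg_ae (.of_forall fun x => by positivity)
      hmeas.aestronglyMeasurable]
    exact ENNReal.toReal_le_of_le_ofReal (by positivity) h
  refine hpot.trans (le_of_eq ?_)
  rw [mul_assoc C]
  congr 1
  rw [Real.mul_rpow hM.le (by positivity), ← Real.rpow_mul hρ.le, mul_assoc, ← Real.rpow_add hρ,
    hρ_def, ← Real.rpow_mul (by positivity), Real.div_rpow hL.le hM.le, El,
    Real.rpow_sub hM]
  have e : (1 : ℝ) / 2 * ((N : ℝ) / 2 * (2 * q) + -((N : ℝ) - -(2 * b))) = Dl N b q := by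
    rw [Dl]; ring
  rw [e]
  field_simp
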